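/- arXiv:1511.05733 — 5 statements merged into one kernel-verified Lean document; each statement's English description precedes it below -/
import Mathlib

section
/- Let n and K be positive integers, let (a_{i,j})_{i,j≥1} be nonnegative real numbers with a_{i,j} = a_{j,i} for all i,j, and let (c_i)_{1≤i≤n} be nonnegative real numbers. Then ∑_{i=1}^n min(i,K) · Q_i^n(c) ≤ 0. (This is the key inequality showing that the cut-off mass t ↦ ∑_i min(i,K) c_i is non-increasing along coagulation.) -/
/-- Truncated coagulation operator of size `n`:
`Q_i^n(c) = (1/2) ∑_{j=1}^{i-1} a_{i-j,j} c_{i-j} c_j − ∑_{j=1}^{n-i} a_{i,j} c_i c_j`. -/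
noncomputable def Qtrunc (a : ℕ → ℕ → ℝ) (c : ℕ → ℝ) (n i : ℕ) : ℝ :=
  (1 / 2) * ∑ j ∈ Finset.Icc 1 (i - 1), a (i - j) j * c (i - j) * c j
    - ∑ j ∈ Finset.Icc 1 (n - i), a i j * c i * c j

/-- Reindexing by `k = i + j` a sum over the triangle `i, j ≥ 1`, `i + j ≤ n`. -/
theorem sum_antidiagonals_eq_sum_triangle {M : Type*} [AddCommMonoid M] (F : ℕ → ℕ → M) (n : ℕ) :
    ∑ k ∈ Finset.Icc 1 n, ∑ j ∈ Finset.Icc 1 (k - 1), F (k - j) j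
      = ∑ i ∈ Finset.Icc 1 n, ∑ j ∈ Finset.Icc 1 (n - i), F i j := by
  rw [Finset.sum_sigma', Finset.sum_sigma']
  refine Finset.sum_bij' (fun p _ => ⟨p.1 - p.2, p.2⟩) (fun p _ => ⟨p.1 + p.2, p.2⟩) ?_ ?_ ?_ ?_ ?_
  · rintro ⟨k, j⟩ h
    simp only [Finset.mem_sigma, Finset.mem_Icc] at h ⊢
    omega
  · rintro ⟨i, j⟩ h
    simp only [Finset.mem_sigma, Finset.mem_Icc] at h ⊢
    omega
  · rintro ⟨k, j⟩ h
    simp only [Finset.mem_sigma, Finset.mem_Icc] at h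
    have hk : k - j + j = k := by omega
    simp [hk]
  · rintro ⟨i, j⟩ _
    simp
  · intros
    rfl

theorem sum_triangle_comm {M : Type*} [AddCommMonoid M] (F : ℕ → ℕ → M) (n : ℕ) :
    ∑ i ∈ Finset.Icc 1 n, ∑ j ∈ Finset.Icc 1 (n - i), F i j
      = ∑ i ∈ Finset.Icc 1 n, ∑ j ∈ Finset.Icc 1 (n - i), F j i := by
  refine Finset.sum_comm' fun i j => ?_
  simp only [Finset.mem_Icc]
  omega

/-- Weak form of the truncated coagulation operator, tested against `g`. -/
theorem sum_mul_Qtrunc (n : ℕ) (a : ℕ → ℕ → ℝ)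
    (hsym : ∀ i j, 1 ≤ i → 1 ≤ j → a i j = a j i) (c g : ℕ → ℝ) :
    ∑ i ∈ Finset.Icc 1 n, g i * Qtrunc a c n i
      = (1 / 2) * ∑ i ∈ Finset.Icc 1 n, ∑ j ∈ Finset.Icc 1 (n - i),
          (g (i + j) - g i - g j) * (a i j * c i * c j) := by
  have hgain : ∑ i ∈ Finset.Icc 1 n, ∑ j ∈ Finset.Icc 1 (i - 1),
        g i * (a (i - j) j * c (i - j) * c j)
      = ∑ i ∈ Finset.Icc 1 n, ∑ j ∈ Finset.Icc 1 (n - i), g (i + j) * (a i j * c i * c j) := by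
    rw [← sum_antidiagonals_eq_sum_triangle fun i j => g (i + j) * (a i j * c i * c j)]
    refine Finset.sum_congr rfl fun i _ => Finset.sum_congr rfl fun j hj => ?_
    rw [Finset.mem_Icc] at hj
    rw [Nat.sub_add_cancel (by omega)]
  have hloss : ∑ i ∈ Finset.Icc 1 n, ∑ j ∈ Finset.Icc 1 (n - i), g i * (a i j * c i * c j)
      = ∑ i ∈ Finset.Icc 1 n, ∑ j ∈ Finset.Icc 1 (n - i), g j * (a i j * c i * c j) := by
    rw [sum_triangle_comm]
    refine Finset.sum_congr rfl fun i hi => Finset.sum_congr rfl fun j hj => ?_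
    rw [hsym j i (Finset.mem_Icc.1 hj).1 (Finset.mem_Icc.1 hi).1]
    ring
  simp only [Qtrunc, mul_sub, sub_mul, Finset.sum_sub_distrib, mul_left_comm (g _) (1 / 2 : ℝ),
    ← Finset.mul_sum] at hgain hloss ⊢
  rw [hgain]
  linarith

/-- The cut-off mass is non-increasing along truncated coagulation:
`∑_{i=1}^n min(i,K) · Q_i^n(c) ≤ 0`. -/
theorem truncated_cutoff_mass_nonincreasing (n K : ℕ) (hn : 1 ≤ n) (hK : 1 ≤ K)
    (a : ℕ → ℕ → ℝ) (ha : ∀ i j, 1 ≤ i → 1 ≤ j → 0 ≤ a i j)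
    (hsym : ∀ i j, 1 ≤ i → 1 ≤ j → a i j = a j i)
    (c : ℕ → ℝ) (hc : ∀ i, 1 ≤ i → 0 ≤ c i) :
    ∑ i ∈ Finset.Icc 1 n, (min i K : ℝ) * Qtrunc a c n i ≤ 0 := by
  have hweak := sum_mul_Qtrunc n a hsym c fun i => (min i K : ℝ)
  rw [hweak]
  refine mul_nonpos_of_nonneg_of_nonpos (by norm_num) ?_
  refine Finset.sum_nonpos fun i hi => Finset.sum_nonpos fun j hj => ?_
  have hi1 := (Finset.mem_Icc.1 hi).1
  have hj1 := (Finset.mem_Icc.1 hj).1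
  have hsub : (min (i + j : ℕ) K : ℝ) ≤ min (i : ℝ) K + min (j : ℝ) K := by
    have h : min (i + j) K ≤ min i K + min j K := by omega
    exact_mod_cast h
  exact mul_nonpos_of_nonpos_of_nonneg (by linarith)
    (mul_nonneg (mul_nonneg (ha i j hi1 hj1) (hc i hi1)) (hc j hj1))
end

section
/- Let (a_{i,j})_{i,j≥1} be nonnegative real numbers with a_{i,j} = a_{j,i} for all i,j, let (c_i)_{i≥1} be nonnegative real numbers such that the doubly-indexed family (a_{i,j} c_i c_j)_{i,j≥1} is summable, and let (φ_i)_{i≥1} be a bounded sequence of real numbers. Then for each i the series defining Q_i(c) converges absolutely, the series ∑_{i≥1} φ_i Q_i(c) converges, and the weak formulation identity holds: ∑_{i=1}^∞ φ_i Q_i(c) = (1/2) ∑_{i=1}^∞ ∑_{j=1}^∞ a_{i,j} c_i c_j (φ_{i+j} − φ_i − φ_j). -/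
/-- The (full) coagulation operator:
`Q_i(c) = (1/2) ∑_{j=1}^{i-1} a_{i-j,j} c_{i-j} c_j − ∑_{j=1}^∞ a_{i,j} c_i c_j`
(the infinite series over `j ≥ 1` being encoded by a `tsum` over `j+1`, `j : ℕ`). -/
noncomputable def Qcoag (a : ℕ → ℕ → ℝ) (c : ℕ → ℝ) (i : ℕ) : ℝ :=
  (1 / 2) * ∑ j ∈ Finset.Icc 1 (i - 1), a (i - j) j * c (i - j) * c j
    - ∑' j : ℕ, a i (j + 1) * c i * c (j + 1)

/-- Summing an unconditionally summable double family along antidiagonals. -/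
theorem hasSum_sum_antidiagonal {f : ℕ × ℕ → ℝ} {s : ℝ} (hf : HasSum f s) :
    HasSum (fun n => ∑ p ∈ Finset.HasAntidiagonal.antidiagonal n, f p) s := by
  have h := (Finset.HasAntidiagonal.sigmaAntidiagonalEquivProd (A := ℕ)).hasSum_iff.mpr hf
  refine h.sigma fun n => ?_
  have h' := hasSum_fintype (fun p : Finset.HasAntidiagonal.antidiagonal n => f p)
  rwa [Finset.sum_coe_sort (Finset.HasAntidiagonal.antidiagonal n) f] at h'

theorem sum_Icc_coag_eq_sum_antidiagonal (g : ℕ → ℕ → ℝ) (n : ℕ) :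
    ∑ j ∈ Finset.Icc 1 (n + 1), g (n + 2 - j) j
      = ∑ p ∈ Finset.HasAntidiagonal.antidiagonal n, g (p.1 + 1) (p.2 + 1) := by
  refine Finset.sum_bij' (fun j _ => (n + 1 - j, j - 1)) (fun p _ => p.2 + 1) ?_ ?_ ?_ ?_ ?_
  · intro j hj
    simp only [Finset.mem_Icc, Finset.HasAntidiagonal.mem_antidiagonal] at *
    omega
  · intro p hp
    simp only [Finset.mem_Icc, Finset.HasAntidiagonal.mem_antidiagonal] at *
    omega
  · intro j hj
    simp only [Finset.mem_Icc] at *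
    omega
  · intro p hp
    simp only [Finset.HasAntidiagonal.mem_antidiagonal] at hp
    ext <;> simp only <;> omega
  · intro j hj
    simp only [Finset.mem_Icc] at hj
    congr 1 <;> omega

/-- Weak formulation of the coagulation operator: if the family
`(a_{i,j} c_i c_j)_{i,j≥1}` is summable and `(φ_i)` is bounded, then the series defining
each `Q_i(c)` converges absolutely, the series `∑_{i≥1} φ_i Q_i(c)` converges, and
`∑_{i=1}^∞ φ_i Q_i(c) = (1/2) ∑_{i,j≥1} a_{i,j} c_i c_j (φ_{i+j} − φ_i − φ_j)`. -/
theorem weak_formulation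
    (a : ℕ → ℕ → ℝ) (ha : ∀ i j, 1 ≤ i → 1 ≤ j → 0 ≤ a i j)
    (hsym : ∀ i j, 1 ≤ i → 1 ≤ j → a i j = a j i)
    (c : ℕ → ℝ) (hc : ∀ i, 1 ≤ i → 0 ≤ c i)
    (hsum : Summable (fun p : ℕ × ℕ => a (p.1 + 1) (p.2 + 1) * c (p.1 + 1) * c (p.2 + 1)))
    (φ : ℕ → ℝ) (hφ : ∃ B : ℝ, ∀ i : ℕ, |φ i| ≤ B) :
    (∀ i : ℕ, 1 ≤ i → Summable (fun j : ℕ => |a i (j + 1) * c i * c (j + 1)|)) ∧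
    Summable (fun i : ℕ => φ (i + 1) * Qcoag a c (i + 1)) ∧
    ∑' i : ℕ, φ (i + 1) * Qcoag a c (i + 1)
      = (1 / 2) * ∑' p : ℕ × ℕ, a (p.1 + 1) (p.2 + 1) * c (p.1 + 1) * c (p.2 + 1) *
          (φ (p.1 + 1 + (p.2 + 1)) - φ (p.1 + 1) - φ (p.2 + 1)) := by
  obtain ⟨B, hB⟩ := hφ
  set F : ℕ × ℕ → ℝ := fun p => a (p.1 + 1) (p.2 + 1) * c (p.1 + 1) * c (p.2 + 1) with hF
  have summable_mul (u : ℕ × ℕ → ℕ) : Summable (fun p => F p * φ (u p)) := by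
    refine Summable.of_norm_bounded (hsum.abs.mul_right B) fun p => ?_
    rw [Real.norm_eq_abs, abs_mul]
    exact mul_le_mul_of_nonneg_left (hB _) (abs_nonneg _)
  have hG := (summable_mul fun p => p.1 + 1 + (p.2 + 1)).hasSum
  have hH := (summable_mul fun p => p.1 + 1).hasSum
  have hK : HasSum (fun p => F p * φ (p.2 + 1)) (∑' p, F p * φ (p.1 + 1)) := by
    rw [← (Equiv.prodComm ℕ ℕ).hasSum_iff]
    refine hH.congr_fun fun p => ?_
    simp only [hF, Function.comp_apply, Equiv.prodComm_apply, Prod.fst_swap, Prod.snd_swap]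
    rw [hsym (p.2 + 1) (p.1 + 1) (by omega) (by omega)]
    ring
  have hgain : HasSum (fun i => φ (i + 1) *
      ∑ j ∈ Finset.Icc 1 i, a (i + 1 - j) j * c (i + 1 - j) * c j)
      (∑' p : ℕ × ℕ, F p * φ (p.1 + 1 + (p.2 + 1))) := by
    rw [← hasSum_nat_add_iff' 1]
    simp only [Finset.range_one, Finset.sum_singleton, Finset.Icc_eq_empty_of_lt zero_lt_one,
      Finset.sum_empty, mul_zero, sub_zero]
    refine (hasSum_sum_antidiagonal hG).congr_fun fun n => ?_
    rw [sum_Icc_coag_eq_sum_antidiagonal (fun i j => a i j * c i * c j) n, Finset.mul_sum]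
    refine Finset.sum_congr rfl fun p hp => ?_
    rw [Finset.HasAntidiagonal.mem_antidiagonal] at hp
    rw [show p.1 + 1 + (p.2 + 1) = n + 1 + 1 by omega, mul_comm]
  have hloss : HasSum (fun i => φ (i + 1) * ∑' j, F (i, j)) (∑' p, F p * φ (p.1 + 1)) := by
    refine hH.prod_fiberwise fun i => ?_
    rw [mul_comm]
    exact (hsum.prod_factor i).hasSum.mul_right _
  have hQ : HasSum (fun i => φ (i + 1) * Qcoag a c (i + 1))
      ((1 / 2) * ∑' p : ℕ × ℕ, F p * φ (p.1 + 1 + (p.2 + 1)) - ∑' p, F p * φ (p.1 + 1)) := by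
    refine ((hgain.mul_left (1 / 2)).sub hloss).congr_fun fun i => ?_
    simp only [Qcoag, hF, Nat.add_sub_cancel]
    ring
  refine ⟨fun i hi => ?_, hQ.summable, ?_⟩
  · obtain ⟨k, rfl⟩ := Nat.exists_eq_add_of_le' hi
    exact (hsum.prod_factor k).abs
  · have hR := ((hG.sub hH).sub hK).tsum_eq
    have hR' (p : ℕ × ℕ) : F p * (φ (p.1 + 1 + (p.2 + 1)) - φ (p.1 + 1) - φ (p.2 + 1))
        = F p * φ (p.1 + 1 + (p.2 + 1)) - F p * φ (p.1 + 1) - F p * φ (p.2 + 1) := by ring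
    rw [hQ.tsum_eq, tsum_congr hR', hR]
    ring
end

section
/- Let (a_{i,j})_{i,j≥1} be nonnegative real numbers with a_{i,j} = a_{j,i} for all i,j, and let (c_i)_{i≥1} be nonnegative real numbers such that the doubly-indexed family ((i+j) a_{i,j} c_i c_j)_{i,j≥1} is summable. Then the series ∑_{i≥1} i·Q_i(c) converges and ∑_{i=1}^∞ i·Q_i(c) = 0, i.e. the coagulation operator formally conserves the total mass ρ_1 = ∑_i i c_i. -/
/-- A sum over pairs of naturals may be rearranged along the antidiagonals. -/
theorem HasSum.sum_antidiagonal {w : ℕ × ℕ → ℝ} {S : ℝ} (hw : HasSum w S) :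
    HasSum (fun n => ∑ p ∈ Finset.HasAntidiagonal.antidiagonal n, w p) S := by
  have h := (Finset.HasAntidiagonal.sigmaAntidiagonalEquivProd.hasSum_iff (f := w)).2 hw
  refine h.sigma fun n => ?_
  rw [← Finset.sum_coe_sort]
  exact hasSum_fintype _

open Finset in
/-- The finite sum in the gain term, written over an antidiagonal. -/
theorem sum_Icc_coagulation_gain (a : ℕ → ℕ → ℝ) (c : ℕ → ℝ) (n : ℕ) :
    ((n + 2 : ℕ) : ℝ) * ∑ j ∈ Icc 1 (n + 1), a (n + 2 - j) j * c (n + 2 - j) * c j =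
      ∑ p ∈ HasAntidiagonal.antidiagonal n, ((p.1 + 1 + (p.2 + 1) : ℕ) : ℝ) *
        a (p.1 + 1) (p.2 + 1) * c (p.1 + 1) * c (p.2 + 1) := by
  rw [mul_sum]
  symm
  refine sum_bij' (fun p _ => p.2 + 1) (fun j _ => (n + 1 - j, j - 1)) ?_ ?_ ?_ ?_ ?_
  · rintro ⟨x, y⟩ h
    simp only [HasAntidiagonal.mem_antidiagonal, mem_Icc] at *
    omega
  · intro j h
    simp only [HasAntidiagonal.mem_antidiagonal, mem_Icc] at *
    omega
  · rintro ⟨x, y⟩ h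
    simp only [HasAntidiagonal.mem_antidiagonal, Prod.mk.injEq] at *
    omega
  · intro j h
    simp only [mem_Icc] at *
    omega
  · rintro ⟨x, y⟩ h
    simp only [HasAntidiagonal.mem_antidiagonal] at *
    rw [show n + 2 - (y + 1) = x + 1 by omega, show x + 1 + (y + 1) = n + 2 by omega]
    ring

/-- Formal conservation of mass by the coagulation operator: if the family
`((i+j) a_{i,j} c_i c_j)_{i,j≥1}` is summable, then the series `∑_{i≥1} i·Q_i(c)`
converges and `∑_{i=1}^∞ i·Q_i(c) = 0`. -/
theorem coagulation_mass_conservation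
    (a : ℕ → ℕ → ℝ) (ha : ∀ i j, 1 ≤ i → 1 ≤ j → 0 ≤ a i j)
    (hsym : ∀ i j, 1 ≤ i → 1 ≤ j → a i j = a j i)
    (c : ℕ → ℝ) (hc : ∀ i, 1 ≤ i → 0 ≤ c i)
    (hsum : Summable (fun p : ℕ × ℕ =>
      ((p.1 + 1 + (p.2 + 1) : ℕ) : ℝ) * a (p.1 + 1) (p.2 + 1) * c (p.1 + 1) * c (p.2 + 1))) :
    Summable (fun i : ℕ => ((i + 1 : ℕ) : ℝ) * Qcoag a c (i + 1)) ∧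
    ∑' i : ℕ, ((i + 1 : ℕ) : ℝ) * Qcoag a c (i + 1) = 0 := by
  set w : ℕ × ℕ → ℝ := fun p =>
    ((p.1 + 1 + (p.2 + 1) : ℕ) : ℝ) * a (p.1 + 1) (p.2 + 1) * c (p.1 + 1) * c (p.2 + 1) with hw
  set F : ℕ × ℕ → ℝ := fun p =>
    ((p.1 + 1 : ℕ) : ℝ) * (a (p.1 + 1) (p.2 + 1) * c (p.1 + 1) * c (p.2 + 1)) with hF
  have hb (p : ℕ × ℕ) : 0 ≤ a (p.1 + 1) (p.2 + 1) * c (p.1 + 1) * c (p.2 + 1) :=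
    mul_nonneg (mul_nonneg (ha _ _ (by omega) (by omega)) (hc _ (by omega))) (hc _ (by omega))
  have hwF (p : ℕ × ℕ) : w p = F p + F p.swap := by
    simp only [hw, hF, Prod.fst_swap, Prod.snd_swap]
    rw [hsym (p.2 + 1) (p.1 + 1) (by omega) (by omega)]
    push_cast
    ring
  have hF0 (p : ℕ × ℕ) : 0 ≤ F p := mul_nonneg (Nat.cast_nonneg _) (hb p)
  have hFs : Summable F := hsum.of_nonneg_of_le hF0 fun p => by
    rw [hwF]
    exact le_add_of_nonneg_right (hF0 _)
  obtain ⟨T, hT⟩ := hFs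
  have hwT : HasSum w (T + T) := by
    rw [funext hwF]
    exact hT.add ((Equiv.prodComm ℕ ℕ).hasSum_iff.2 hT)
  have hloss : HasSum (fun i : ℕ =>
      ((i + 1 : ℕ) : ℝ) * ∑' j : ℕ, a (i + 1) (j + 1) * c (i + 1) * c (j + 1)) T := by
    simp only [← tsum_mul_left]
    exact hT.prod_fiberwise fun i => (hT.summable.prod_factor i).hasSum
  have hgain : HasSum (fun i : ℕ => ((i + 1 : ℕ) : ℝ) *
      ∑ j ∈ Finset.Icc 1 i, a (i + 1 - j) j * c (i + 1 - j) * c j) (T + T) := by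
    rw [← hasSum_nat_add_iff' 1]
    have h := hwT.sum_antidiagonal
    simp only [hw, ← sum_Icc_coagulation_gain] at h
    simpa [add_assoc] using h
  have hQ : HasSum (fun i : ℕ => ((i + 1 : ℕ) : ℝ) * Qcoag a c (i + 1)) 0 := by
    have h := (hgain.mul_left (1 / 2)).sub hloss
    rw [show 1 / 2 * (T + T) - T = 0 by ring] at h
    simpa only [Qcoag, Nat.add_sub_cancel, mul_sub, mul_left_comm _ (1 / 2 : ℝ)] using h
  exact ⟨hQ.summable, hQ.tsum_eq⟩
end

section
/- Let C ≥ 0, let (a_{i,j})_{i,j≥1} be nonnegative real numbers with a_{i,j} ≤ C(i+j) for all i,j ≥ 1, let (c_i)_{i≥1} be nonnegative real numbers, and let I be a positive integer. Then, with sums taken in [0,+∞], ∑_{i=1}^∞ ∑_{j=1}^∞ a_{i,j} c_i c_j · i · (1_{i+j≥I} − 1_{i≥I}) ≤ 2C · (∑_{i=1}^{I−1} i² c_i) · (∑_{j=1}^∞ j c_j), where 1_P denotes the indicator (equal to 1 if condition P holds, and 0 otherwise). -/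
open ENNReal

/-- A sum over `1 ≤ i < I` as an unconditional sum with the index shifted by one. -/
lemma sum_Icc_one_eq_tsum_ite (f : ℕ → ℝ≥0∞) (I : ℕ) :
    ∑ i ∈ Finset.Icc 1 (I - 1), f i = ∑' i : ℕ, if i + 1 < I then f (i + 1) else 0 := by
  rw [tsum_eq_sum (s := Finset.range (I - 1))]
  · refine (Finset.sum_bij (fun i _ => i + 1) ?_ ?_ ?_ ?_).symm
    · intro i hi
      simp only [Finset.mem_range, Finset.mem_Icc] at *
      omega
    · intro i _ j _ h
      omega
    · intro i hi
      rw [Finset.mem_Icc] at hi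
      exact ⟨i - 1, by rw [Finset.mem_range]; omega, by omega⟩
    · intro i hi
      rw [Finset.mem_range] at hi
      rw [if_pos (by omega)]
  · intro i hi
    rw [Finset.mem_range] at hi
    rw [if_neg (by omega)]

/-- Pointwise bound on the kernel: linear growth of `a` combined with `i + j ≤ 2 i j` for `i, j ≥ 1`. -/
lemma mul_mul_mul_le_of_le_mul_add {C a x y i j : ℝ} (hC : 0 ≤ C) (ha : a ≤ C * (i + j))
    (hx : 0 ≤ x) (hy : 0 ≤ y) (hi : 1 ≤ i) (hj : 1 ≤ j) :
    a * x * y * i ≤ 2 * C * (i ^ 2 * x) * (j * y) := by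
  have hij : i + j ≤ 2 * (i * j) := by nlinarith
  calc a * x * y * i = a * (x * y * i) := by ring
    _ ≤ C * (2 * (i * j)) * (x * y * i) := by
      have := ha.trans (mul_le_mul_of_nonneg_left hij hC)
      gcongr
    _ = 2 * C * (i ^ 2 * x) * (j * y) := by ring

/-- Tail mass estimate (sums taken in `[0,+∞]`): if `0 ≤ a_{i,j} ≤ C(i+j)`, then
`∑_{i,j≥1} a_{i,j} c_i c_j · i · (1_{i+j≥I} − 1_{i≥I})
  ≤ 2C (∑_{i=1}^{I−1} i² c_i) (∑_{j≥1} j c_j)`. -/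
theorem tail_mass_estimate (C : ℝ) (hC : 0 ≤ C)
    (a : ℕ → ℕ → ℝ) (ha : ∀ i j, 1 ≤ i → 1 ≤ j → 0 ≤ a i j)
    (hbd : ∀ i j, 1 ≤ i → 1 ≤ j → a i j ≤ C * ((i : ℝ) + (j : ℝ)))
    (c : ℕ → ℝ) (hc : ∀ i, 1 ≤ i → 0 ≤ c i)
    (I : ℕ) (hI : 1 ≤ I) :
    ∑' p : ℕ × ℕ, ENNReal.ofReal
        (a (p.1 + 1) (p.2 + 1) * c (p.1 + 1) * c (p.2 + 1) * ((p.1 + 1 : ℕ) : ℝ) *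
          ((if I ≤ p.1 + 1 + (p.2 + 1) then 1 else 0) - (if I ≤ p.1 + 1 then 1 else 0)))
      ≤ 2 * ENNReal.ofReal C *
          (∑ i ∈ Finset.Icc 1 (I - 1), ENNReal.ofReal ((i : ℝ) ^ 2 * c i)) *
          ∑' j : ℕ, ENNReal.ofReal (((j + 1 : ℕ) : ℝ) * c (j + 1)) := by
  rw [sum_Icc_one_eq_tsum_ite, ← ENNReal.tsum_mul_left (a := 2 * ENNReal.ofReal C),
    ← ENNReal.tsum_mul_right, ENNReal.tsum_prod']
  refine ENNReal.tsum_le_tsum fun i => ?_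
  rw [← ENNReal.tsum_mul_left]
  refine ENNReal.tsum_le_tsum fun j => ?_
  dsimp only
  by_cases h : i + 1 < I
  · have hci := hc (i + 1) (by omega)
    have hcj := hc (j + 1) (by omega)
    have hi : (1 : ℝ) ≤ ((i + 1 : ℕ) : ℝ) := by exact_mod_cast Nat.le_add_left 1 i
    have hj : (1 : ℝ) ≤ ((j + 1 : ℕ) : ℝ) := by exact_mod_cast Nat.le_add_left 1 j
    have haij := ha (i + 1) (j + 1) (by omega) (by omega)
    have hle := mul_mul_mul_le_of_le_mul_add hC
      (hbd (i + 1) (j + 1) (by omega) (by omega)) hci hcj hi hj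
    rw [if_pos h, if_neg (by omega : ¬ I ≤ i + 1), ← ENNReal.ofReal_ofNat 2,
      ← ENNReal.ofReal_mul (by norm_num), ← ENNReal.ofReal_mul (by positivity),
      ← ENNReal.ofReal_mul (by positivity)]
    refine ENNReal.ofReal_le_ofReal (le_trans ?_ hle)
    refine mul_le_of_le_one_right (by positivity) ?_
    split_ifs <;> norm_num
  · rw [if_pos (by omega : I ≤ i + 1 + (j + 1)), if_pos (by omega : I ≤ i + 1)]
    simp
end

section
/- For every natural number k one has sup_{i≥1} ∑_{j=1}^{i−1} j^{k+1} / ( (i−j)^{k+2} · j^{k+2} ) ≤ 2^{k+3} ∑_{j=1}^∞ 1/j^{k+2}; in particular this supremum is finite. -/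
/-- Uniform-in-`i` bound on the convolution-type sum of Lemma 4.1: for every `k : ℕ`,
`sup_{i≥1} ∑_{j=1}^{i−1} j^{k+1} / ((i−j)^{k+2} j^{k+2}) ≤ 2^{k+3} ∑_{j=1}^∞ 1/j^{k+2}`. -/
theorem convolution_sum_uniform_bound (k : ℕ) :
    ∀ i : ℕ, 1 ≤ i →
      ∑ j ∈ Finset.Icc 1 (i - 1),
          (j : ℝ) ^ (k + 1) / (((i - j : ℕ) : ℝ) ^ (k + 2) * (j : ℝ) ^ (k + 2))
        ≤ 2 ^ (k + 3) * ∑' j : ℕ, 1 / ((j + 1 : ℕ) : ℝ) ^ (k + 2) := by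
  intro i _
  have hs : Summable fun j : ℕ => 1 / ((j + 1 : ℕ) : ℝ) ^ (k + 2) :=
    (summable_nat_add_iff 1).2 (Real.summable_one_div_nat_pow.2 (by omega : 1 < k + 2))
  have h_term : ∀ j ∈ Finset.Icc 1 (i - 1),
      (j : ℝ) ^ (k + 1) / (((i - j : ℕ) : ℝ) ^ (k + 2) * (j : ℝ) ^ (k + 2))
        ≤ 1 / ((i - j : ℕ) : ℝ) ^ (k + 2) := by
    intro j hj
    obtain ⟨hj₁, hj₂⟩ := Finset.mem_Icc.1 hj
    have h_one : (1 : ℝ) ≤ j := by exact_mod_cast hj₁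
    have h_pos : (0 : ℝ) < ((i - j : ℕ) : ℝ) := by exact_mod_cast (by omega : 0 < i - j)
    rw [div_le_div_iff₀ (by positivity) (by positivity), one_mul, mul_comm]
    gcongr
    · exact one_le_two
  have h_reindex : ∑ j ∈ Finset.Icc 1 (i - 1), 1 / ((i - j : ℕ) : ℝ) ^ (k + 2)
      = ∑ m ∈ Finset.range (i - 1), 1 / ((m + 1 : ℕ) : ℝ) ^ (k + 2) := by
    refine Finset.sum_nbij' (fun j => i - 1 - j) (fun m => i - 1 - m) ?_ ?_ ?_ ?_ ?_
    all_goals intro j hj; simp only [Finset.mem_Icc, Finset.mem_range] at hj ⊢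
    · omega
    · omega
    · omega
    · omega
    · rw [show i - 1 - j + 1 = i - j by omega]
  calc
    _ ≤ ∑ j ∈ Finset.Icc 1 (i - 1), 1 / ((i - j : ℕ) : ℝ) ^ (k + 2) := Finset.sum_le_sum h_term
    _ ≤ ∑' j : ℕ, 1 / ((j + 1 : ℕ) : ℝ) ^ (k + 2) :=
      h_reindex.trans_le (hs.sum_le_tsum _ fun _ _ => by positivity)
    _ ≤ _ := le_mul_of_one_le_left (tsum_nonneg fun _ => by positivity)
      (one_le_pow₀ one_le_two)
end
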